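/- Let (𝒜, ℬ, 𝒞) be a recollement of abelian categories with enough projectives. Assume that pd_ℬ i(A) ≤ 1 for every object A of 𝒜. Then max{Findim 𝒜, Findim 𝒞} ≤ Findim ℬ ≤ Findim 𝒞 + 2; in particular, Findim ℬ < ∞ if and only if Findim 𝒞 < ∞. -/

import Mathlib

/-!
A recollement `(𝒜, ℬ, 𝒞)` of abelian categories consists of functors `i : 𝒜 ⥤ ℬ`,
`e : ℬ ⥤ 𝒞`, `q, p : ℬ ⥤ 𝒜` and `l, r : 𝒞 ⥤ ℬ` such that `(l, e)`, `(e, r)`, `(q, i)`,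
`(i, p)` are adjoint pairs, the functors `i`, `l` and `r` are fully faithful, and the
essential image of `i` equals the kernel of `e`.

STATEMENT: suppose the categories have enough projectives and `pd_ℬ i(A) ≤ 1` for every
object `A` of `𝒜`.  Then `max {Findim 𝒜, Findim 𝒞} ≤ Findim ℬ ≤ Findim 𝒞 + 2`;
in particular `Findim ℬ < ∞` iff `Findim 𝒞 < ∞`.
-/

open CategoryTheory CategoryTheory.Limits

universe w v₁ v₂ v₃ u₁ u₂ u₃

/-- A recollement `(𝒜, ℬ, 𝒞)` of abelian categories. -/
structure Recollement (A : Type u₁) (B : Type u₂) (C : Type u₃)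
    [Category.{v₁} A] [Category.{v₂} B] [Category.{v₃} C]
    [Abelian A] [Abelian B] [Abelian C] where
  /-- the inclusion functor -/
  i : A ⥤ B
  /-- the quotient functor -/
  e : B ⥤ C
  /-- the left adjoint of `i` -/
  q : B ⥤ A
  /-- the right adjoint of `i` -/
  p : B ⥤ A
  /-- the left adjoint of `e` -/
  l : C ⥤ B
  /-- the right adjoint of `e` -/
  r : C ⥤ B
  /-- `(l, e)` is an adjoint pair -/
  adj_le : l ⊣ e
  /-- `(e, r)` is an adjoint pair -/
  adj_er : e ⊣ r
  /-- `(q, i)` is an adjoint pair -/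
  adj_qi : q ⊣ i
  /-- `(i, p)` is an adjoint pair -/
  adj_ip : i ⊣ p
  i_full : i.Full
  i_faithful : i.Faithful
  l_full : l.Full
  l_faithful : l.Faithful
  r_full : r.Full
  r_faithful : r.Faithful
  /-- the essential image of `i` is the kernel of `e` -/
  essImage_i_eq_ker_e : ∀ X : B, i.essImage X ↔ IsZero (e.obj X)

/-- The projective dimension of an object of an abelian category, as an element of `ℕ∞`:
the least `n` such that `X` admits a projective resolution
`0 → P_n → ⋯ → P_0 → X → 0` (and `⊤` if there is no such `n`). -/
noncomputable def projDim {C : Type u₁} [Category.{v₁} C] [Abelian C] (X : C) : ℕ∞ :=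
  ⨅ (n : ℕ) (_ : ∃ P : CategoryTheory.ProjectiveResolution X,
    ∀ k, n < k → IsZero (P.complex.X k)), (n : ℕ∞)

/-- The injective dimension of an object of an abelian category, as an element of `ℕ∞`:
the least `n` such that `X` admits an injective coresolution
`0 → X → I^0 → ⋯ → I^n → 0` (and `⊤` if there is no such `n`). -/
noncomputable def injDim {C : Type u₁} [Category.{v₁} C] [Abelian C] (X : C) : ℕ∞ :=
  ⨅ (n : ℕ) (_ : ∃ I : CategoryTheory.InjectiveResolution X,
    ∀ k, n < k → IsZero (I.cocomplex.X k)), (n : ℕ∞)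

/-- The finitistic projective dimension of an abelian category: the supremum of the
projective dimensions of the objects having finite projective dimension. -/
noncomputable def catFindim (C : Type u₁) [Category.{v₁} C] [Abelian C] : ℕ∞ :=
  ⨆ (X : C) (_ : projDim X ≠ ⊤), projDim X

/-- An object of an abelian category has finite length if it admits a finite filtration
`⊥ = X_0 < X_1 < ⋯ < X_n = ⊤` by subobjects whose successive quotients are simple
(a finite composition series). -/
def FiniteLengthObj {C : Type u₁} [Category.{v₁} C] [Abelian C] (X : C) : Prop :=
  ∃ (n : ℕ) (f : Fin (n + 1) → Subobject X), f 0 = ⊥ ∧ f (Fin.last n) = ⊤ ∧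
    ∀ j : Fin n, ∃ h : f j.castSucc ≤ f j.succ,
      Simple (cokernel (Subobject.ofLE (f j.castSucc) (f j.succ) h))

/-- An abelian category is a finite length category if every object has a finite
composition series. -/
def FiniteLengthCategory (C : Type u₁) [Category.{v₁} C] [Abelian C] : Prop :=
  ∀ X : C, FiniteLengthObj X

/-- An abelian category has projective covers if every object `X` admits an epimorphism
`f : P → X` with `P` projective whose kernel is superfluous, i.e. contained in the radical
of `P` (the intersection of all maximal subobjects of `P`). -/
def HasProjectiveCovers (C : Type u₁) [Category.{v₁} C] [Abelian C] : Prop :=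
  ∀ X : C, ∃ (P : C) (_ : Projective P) (f : P ⟶ X), Epi f ∧
    ∀ m : Subobject P, IsCoatom m → kernelSubobject f ≤ m

namespace CategoryTheory

section

variable {C : Type u₁} [Category.{v₁} C] [Abelian C]

lemma ProjectiveResolution.hasProjectiveDimensionLE {X : C} (P : ProjectiveResolution X) {n : ℕ}
    (hP : ∀ k, n < k → IsZero (P.complex.X k)) : HasProjectiveDimensionLE X n := by
  let := HasExt.standard C
  refine HasProjectiveDimensionLT.mk fun k hk Y e ↦ ?_
  obtain ⟨f, hf, rfl⟩ := P.extMk_surjective e (k + 1) rfl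
  obtain rfl := (hP k hk).eq_of_src f 0
  simp

/-- A projective resolution of `K` can be spliced with a short exact sequence
`0 → K → P → X → 0` whose middle term is projective to a projective resolution of `X`. -/
lemma ShortComplex.ShortExact.exists_projectiveResolution {S : ShortComplex C}
    (hS : S.ShortExact) (hP : Projective S.X₂) (Q : ProjectiveResolution S.X₁) :
    ∃ P : ProjectiveResolution S.X₃, ∀ k, P.complex.X (k + 1) = Q.complex.X k := by
  have := hS.mono_f
  have := hS.epi_g
  let q : Q.complex.X 0 ⟶ S.X₁ := Q.π.f 0
  have hq : Q.complex.d 1 0 ≫ q = 0 := Q.complex_d_comp_π_f_zero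
  have : Epi q := inferInstanceAs (Epi (Q.π.f 0))
  have hw : Q.complex.d 1 0 ≫ q ≫ S.f = 0 := by rw [reassoc_of% hq, zero_comp]
  let K : ChainComplex C ℕ := ChainComplex.augment Q.complex (q ≫ S.f) hw
  have hK : K.d 1 0 ≫ S.g = 0 := by
    change (q ≫ S.f) ≫ S.g = 0
    simp
  have h₀ : (ShortComplex.mk _ _ hK).Exact := by
    let α : ShortComplex.mk _ _ hK ⟶ S :=
      { τ₁ := q
        τ₂ := 𝟙 _
        τ₃ := 𝟙 _
        comm₁₂ := (Category.comp_id _).symm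
        comm₂₃ := (Category.id_comp _).trans (Category.comp_id _).symm }
    have : Epi α.τ₁ := ‹Epi q›
    have : IsIso α.τ₂ := inferInstanceAs (IsIso (𝟙 _))
    have : Mono α.τ₃ := inferInstanceAs (Mono (𝟙 _))
    exact (ShortComplex.exact_iff_of_epi_of_isIso_of_mono α).2 hS.exact
  have h₁ : (ShortComplex.mk _ _ hw).Exact := by
    have : (ShortComplex.mk _ _ hq).Exact :=
      ShortComplex.exact_of_g_is_cokernel _ Q.isColimitCokernelCofork
    let β : ShortComplex.mk _ _ hq ⟶ ShortComplex.mk _ _ hw :=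
      { τ₁ := 𝟙 _
        τ₂ := 𝟙 _
        τ₃ := S.f }
    have : Epi β.τ₁ := inferInstanceAs (Epi (𝟙 _))
    have : IsIso β.τ₂ := inferInstanceAs (IsIso (𝟙 _))
    have : Mono β.τ₃ := ‹Mono S.f›
    rwa [← ShortComplex.exact_iff_of_epi_of_isIso_of_mono β]
  have hex : ∀ n, K.ExactAt (n + 1) := by
    intro n
    rw [HomologicalComplex.exactAt_iff' _ (n + 1 + 1) (n + 1) n (by simp) (by simp)]
    match n with
    | 0 => exact h₁
    | n + 1 => exact Q.exact_succ n
  refine ⟨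
    { complex := K
      projective := ?_
      π := (ChainComplex.toSingle₀Equiv _ _).symm ⟨S.g, hK⟩
      quasiIso := ⟨fun n ↦ ?_⟩ }, fun k ↦ rfl⟩
  · rintro (_ | n)
    · exact hP
    · exact Q.projective n
  · cases n with
    | zero =>
      rw [ChainComplex.quasiIsoAt₀_iff, ShortComplex.quasiIso_iff_of_zeros']
      · refine (ShortComplex.exact_and_epi_g_iff_of_iso ?_).2 ⟨h₀, ‹Epi S.g›⟩
        exact ShortComplex.isoMk (Iso.refl _) (Iso.refl _) (Iso.refl _)
          ((Category.id_comp _).trans (Category.comp_id _).symm)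
          (by
            erw [Category.id_comp, Category.comp_id]
            exact (ChainComplex.toSingle₀Equiv_symm_apply_f_zero (C := K) (X := S.X₃) S.g hK).symm)
      all_goals rfl
    | succ n =>
      rw [quasiIsoAt_iff_exactAt']
      · exact hex n
      · apply ChainComplex.exactAt_succ_single_obj

lemma ShortComplex.shortExact_kernel_projective_π [EnoughProjectives C] (X : C) :
    (ShortComplex.mk _ _ (kernel.condition (Projective.π X))).ShortExact where
  exact := ShortComplex.exact_of_f_is_kernel _ (kernelIsKernel _)

lemma HasProjectiveDimensionLE.exists_projectiveResolution [EnoughProjectives C] (n : ℕ) :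
    ∀ (X : C), HasProjectiveDimensionLE X n →
      ∃ P : ProjectiveResolution X, ∀ k, n < k → IsZero (P.complex.X k) := by
  induction n with
  | zero =>
    intro X hX
    have := projective_iff_hasProjectiveDimensionLE_zero X |>.2 hX
    exact ⟨ProjectiveResolution.self X, fun k hk ↦
      HomologicalComplex.isZero_single_obj_X _ _ _ _ hk.ne'⟩
  | succ n ih =>
    intro X hX
    have hS := ShortComplex.shortExact_kernel_projective_π X
    obtain ⟨Q, hQ⟩ := ih _
      ((hS.hasProjectiveDimensionLT_X₃_iff n (Projective.projective_over X)).1 hX)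
    obtain ⟨P, hP⟩ := hS.exists_projectiveResolution (Projective.projective_over X) Q
    refine ⟨P, fun k hk ↦ ?_⟩
    obtain _ | k := k
    · lia
    · rw [hP]
      exact hQ k (by lia)

end

end CategoryTheory

section

variable {C : Type u₁} [Category.{v₁} C] [Abelian C]

lemma projDim_le_iff [EnoughProjectives C] (X : C) (n : ℕ) :
    projDim X ≤ n ↔ HasProjectiveDimensionLE X n := by
  refine ⟨fun h ↦ ?_, fun h ↦ iInf₂_le n (h.exists_projectiveResolution n X)⟩
  have h' : projDim X < (n + 1 : ℕ) := lt_of_le_of_lt h (by exact_mod_cast n.lt_succ_self)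
  simp only [projDim, iInf_lt_iff] at h'
  obtain ⟨m, ⟨P, hP⟩, hm⟩ := h'
  have hm : m < n + 1 := by exact_mod_cast hm
  exact P.hasProjectiveDimensionLE fun k hk ↦ hP k (by lia)

lemma projDim_le_add_of_forall {D : Type u₂} [Category.{v₂} D] [Abelian D] [EnoughProjectives C]
    [EnoughProjectives D] {X : C} {Y : D} (m : ℕ)
    (h : ∀ n, HasProjectiveDimensionLE Y n → HasProjectiveDimensionLE X (n + m)) :
    projDim X ≤ projDim Y + m := by
  induction hY : projDim Y with
  | top => simp
  | coe n =>
    rw [← Nat.cast_add, projDim_le_iff]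
    exact h n ((projDim_le_iff Y n).1 hY.le)

lemma projDim_eq_of_iso [EnoughProjectives C] {X Y : C} (φ : X ≅ Y) : projDim X = projDim Y := by
  apply le_antisymm
  · simpa using projDim_le_add_of_forall (X := X) (Y := Y) 0 fun n _ ↦
      hasProjectiveDimensionLT_of_iso φ.symm (n + 1)
  · simpa using projDim_le_add_of_forall (X := Y) (Y := X) 0 fun n _ ↦
      hasProjectiveDimensionLT_of_iso φ (n + 1)

lemma projDim_le_catFindim {X : C} (hX : projDim X ≠ ⊤) : projDim X ≤ catFindim C :=
  le_iSup₂_of_le X hX le_rfl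

end

namespace Recollement

variable {A : Type u₁} {B : Type u₂} {C : Type u₃}
  [Category.{v₁} A] [Category.{v₂} B] [Category.{v₃} C]
  [Abelian A] [Abelian B] [Abelian C] (R : Recollement A B C)

instance : R.i.Full := R.i_full

instance : R.i.Faithful := R.i_faithful

instance : R.l.Full := R.l_full

instance : R.l.Faithful := R.l_faithful

instance : R.i.IsLeftAdjoint := R.adj_ip.isLeftAdjoint

instance : R.e.IsLeftAdjoint := R.adj_er.isLeftAdjoint

instance : R.q.IsLeftAdjoint := R.adj_qi.isLeftAdjoint

instance : PreservesFiniteLimits R.e :=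
  have := R.adj_le.rightAdjoint_preservesLimits
  inferInstance

instance : PreservesFiniteColimits R.e :=
  have := R.adj_er.leftAdjoint_preservesColimits
  inferInstance

instance : PreservesFiniteColimits R.q :=
  have := R.adj_qi.leftAdjoint_preservesColimits
  inferInstance

instance : R.e.Additive := Functor.additive_of_preserves_binary_products _

lemma eq_zero_of_isZero_e {Z : C} {X : B} (hX : IsZero (R.e.obj X)) (f : R.l.obj Z ⟶ X) :
    f = 0 :=
  (R.adj_le.homEquiv _ _).injective (hX.eq_of_tgt _ _)

lemma isZero_e_i (X : A) : IsZero (R.e.obj (R.i.obj X)) :=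
  (R.essImage_i_eq_ker_e _).1 (R.i.obj_mem_essImage X)

lemma isZero_e_of_mono_comp_counit_eq_zero {K M : B} (k : K ⟶ R.l.obj (R.e.obj M)) [Mono k]
    (hk : k ≫ R.adj_le.counit.app M = 0) : IsZero (R.e.obj K) := by
  refine IsZero.of_mono_eq_zero (R.e.map k) ?_
  rw [← cancel_mono (R.e.map (R.adj_le.counit.app M)), ← Functor.map_comp, hk,
    Functor.map_zero, zero_comp]

lemma isZero_e_of_counit_comp_epi_eq_zero {M Q : B} (c : M ⟶ Q) [Epi c]
    (hc : R.adj_le.counit.app M ≫ c = 0) : IsZero (R.e.obj Q) := by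
  refine IsZero.of_epi_eq_zero (R.e.map c) ?_
  rw [← cancel_epi (R.e.map (R.adj_le.counit.app M)), ← Functor.map_comp, hc,
    Functor.map_zero, comp_zero]

lemma counit_comp_unit (M : B) : R.adj_le.counit.app M ≫ R.adj_qi.unit.app M = 0 :=
  R.eq_zero_of_isZero_e (R.isZero_e_i _) _

lemma unit_comp_injective {M : B} {Y : A} {f g : R.i.obj (R.q.obj M) ⟶ R.i.obj Y}
    (h : R.adj_qi.unit.app M ≫ f = R.adj_qi.unit.app M ≫ g) : f = g := by
  obtain ⟨f, rfl⟩ := R.i.map_surjective f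
  obtain ⟨g, rfl⟩ := R.i.map_surjective g
  congr 1
  apply (R.adj_qi.homEquiv _ _).injective
  simpa only [Adjunction.homEquiv_unit] using h

/-- The unit `M ⟶ i q M` is a cokernel of the counit `l e M ⟶ M`. -/
lemma exists_cokernelIso (M : B) :
    ∃ φ : cokernel (R.adj_le.counit.app M) ≅ R.i.obj (R.q.obj M),
      cokernel.π (R.adj_le.counit.app M) ≫ φ.hom = R.adj_qi.unit.app M := by
  obtain ⟨Y, ⟨ψ⟩⟩ := (R.essImage_i_eq_ker_e _).2
    (R.isZero_e_of_counit_comp_epi_eq_zero (cokernel.π (R.adj_le.counit.app M)) (by simp))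
  let c : R.i.obj (R.q.obj M) ⟶ cokernel (R.adj_le.counit.app M) :=
    R.i.map ((R.adj_qi.homEquiv M Y).symm (cokernel.π _ ≫ ψ.inv)) ≫ ψ.hom
  have hc : R.adj_qi.unit.app M ≫ c = cokernel.π _ := by
    have := (R.adj_qi.homEquiv M Y).apply_symm_apply
      (cokernel.π (R.adj_le.counit.app M) ≫ ψ.inv)
    rw [Adjunction.homEquiv_unit] at this
    dsimp only [c]
    rw [reassoc_of% this, Iso.inv_hom_id, Category.comp_id]
  refine ⟨⟨cokernel.desc _ _ (R.counit_comp_unit M), c, ?_, ?_⟩, ?_⟩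
  · rw [← cancel_epi (cokernel.π _), cokernel.π_desc_assoc, hc, Category.comp_id]
  · apply R.unit_comp_injective
    rw [reassoc_of% hc, cokernel.π_desc]
    exact (Category.comp_id _).symm
  · exact cokernel.π_desc _ _ _

instance epi_unit (M : B) : Epi (R.adj_qi.unit.app M) := by
  obtain ⟨φ, hφ⟩ := R.exists_cokernelIso M
  rw [← hφ]
  infer_instance

lemma exact_counit_unit (M : B) :
    (ShortComplex.mk _ _ (R.counit_comp_unit M)).Exact := by
  obtain ⟨φ, hφ⟩ := R.exists_cokernelIso M
  exact ShortComplex.exact_of_g_is_cokernel _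
    (IsColimit.ofIsoColimit (cokernelIsCokernel _) (Cofork.ext φ hφ))

lemma mono_i_map_q_map {K M : B} (f : K ⟶ M) [Mono f] [Epi (R.e.map f)] :
    Mono (R.i.map (R.q.map f)) := by
  have : IsIso (R.e.map f) := isIso_of_mono_of_epi _
  have hη : R.adj_qi.unit.app K ≫ R.i.map (R.q.map f) = f ≫ R.adj_qi.unit.app M :=
    (R.adj_qi.unit.naturality f).symm
  have hε : R.l.map (R.e.map f) ≫ R.adj_le.counit.app M = R.adj_le.counit.app K ≫ f :=
    R.adj_le.counit.naturality f
  refine Preadditive.mono_of_cancel_zero _ fun {T} t ht ↦ ?_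
  obtain ⟨T₁, π₁, _, x, hx⟩ := surjective_up_to_refinements_of_epi (R.adj_qi.unit.app K) t
  obtain ⟨T₂, π₂, _, y, hy⟩ := (R.exact_counit_unit M).exact_up_to_refinements (x ≫ f) (by
    dsimp
    rw [Category.assoc, ← hη, ← reassoc_of% hx, ht, comp_zero])
  dsimp at y hy
  have hz : π₂ ≫ x = (y ≫ inv (R.l.map (R.e.map f))) ≫ R.adj_le.counit.app K := by
    rw [← cancel_mono f, Category.assoc, hy, Category.assoc, Category.assoc, ← hε,
      IsIso.inv_hom_id_assoc]
  rw [← cancel_epi π₁, hx, ← cancel_epi π₂, reassoc_of% hz, R.counit_comp_unit]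
  simp

lemma hasProjectiveDimensionLE_one
    (h : ∀ X : A, HasProjectiveDimensionLE (R.i.obj X) 1) {X : B} (hX : IsZero (R.e.obj X)) :
    HasProjectiveDimensionLE X 1 := by
  obtain ⟨Y, ⟨φ⟩⟩ := (R.essImage_i_eq_ker_e X).2 hX
  have := h Y
  exact hasProjectiveDimensionLT_of_iso φ 2

lemma shortExact_image_counit (M : B) :
    (ShortComplex.mk (kernel.ι (Abelian.factorThruImage (R.adj_le.counit.app M)))
      (Abelian.factorThruImage (R.adj_le.counit.app M)) (by simp)).ShortExact where
  exact := ShortComplex.exact_of_f_is_kernel _ (kernelIsKernel _)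

lemma isZero_e_kernel (M : B) :
    IsZero (R.e.obj (kernel (Abelian.factorThruImage (R.adj_le.counit.app M)))) :=
  R.isZero_e_of_mono_comp_counit_eq_zero (kernel.ι _) (by
    have := kernel.condition (Abelian.factorThruImage (R.adj_le.counit.app M)) =≫
      Abelian.image.ι _
    rwa [Category.assoc, Abelian.image.fac, zero_comp] at this)

lemma shortExact_cokernel_counit (M : B) :
    (ShortComplex.mk (Abelian.image.ι (R.adj_le.counit.app M))
      (cokernel.π (R.adj_le.counit.app M)) (by simp)).ShortExact where
  exact := ShortComplex.exact_of_f_is_kernel _ (kernelIsKernel _)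
  mono_f := inferInstanceAs (Mono (Abelian.image.ι _))
  epi_g := inferInstanceAs (Epi (cokernel.π _))

lemma isZero_e_cokernel (M : B) : IsZero (R.e.obj (cokernel (R.adj_le.counit.app M))) :=
  R.isZero_e_of_counit_comp_epi_eq_zero (cokernel.π _) (by simp)

/-- If `pd i(A) ≤ 1` for all `A`, then `e` preserves projective objects. -/
lemma projective_e_obj (h : ∀ X : A, HasProjectiveDimensionLE (R.i.obj X) 1) (P : B)
    [Projective P] : Projective (R.e.obj P) := by
  let g := Abelian.factorThruImage (R.adj_le.counit.app P)
  have hI : Projective (Abelian.image (R.adj_le.counit.app P)) := by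
    rw [projective_iff_hasProjectiveDimensionLT_one]
    exact (R.shortExact_cokernel_counit P).hasProjectiveDimensionLT_X₁ 1
      (inferInstanceAs (HasProjectiveDimensionLT P 1))
      (R.hasProjectiveDimensionLE_one h (R.isZero_e_cokernel P))
  let s := Projective.factorThru (𝟙 _) g
  have hs : s ≫ g = 𝟙 _ := Projective.factorThru_comp _ _
  have hl : Projective (R.l.obj (R.e.obj P)) := by
    refine Projective.of_iso ⟨s, g, hs, ?_⟩ hI
    have hk : (𝟙 _ - g ≫ s) ≫ g = 0 := by simp [hs]
    have := kernel.lift_ι g _ hk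
    rw [R.eq_zero_of_isZero_e (R.isZero_e_kernel P) (kernel.lift g _ hk), zero_comp] at this
    exact (sub_eq_zero.1 this.symm).symm
  exact R.adj_le.projective_of_map_projective _ hl

lemma preservesProjectiveObjects_e (h : ∀ X : A, HasProjectiveDimensionLE (R.i.obj X) 1) :
    R.e.PreservesProjectiveObjects where
  projective_obj hP := have := hP; R.projective_e_obj h _

lemma hasProjectiveDimensionLE_e_obj [EnoughProjectives B]
    (h : ∀ X : A, HasProjectiveDimensionLE (R.i.obj X) 1) {n : ℕ} {M : B}
    (hM : HasProjectiveDimensionLE M n) : HasProjectiveDimensionLE (R.e.obj M) n := by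
  obtain ⟨P, hP⟩ := hM.exists_projectiveResolution n M
  have := R.preservesProjectiveObjects_e h
  exact (R.e.mapProjectiveResolution P).hasProjectiveDimensionLE
    fun k hk ↦ R.e.map_isZero (hP k hk)

lemma hasProjectiveDimensionLE_add_two [EnoughProjectives B]
    (h : ∀ X : A, HasProjectiveDimensionLE (R.i.obj X) 1) (n : ℕ) :
    ∀ M : B, HasProjectiveDimensionLE (R.e.obj M) n → HasProjectiveDimensionLE M (n + 2) := by
  induction n with
  | zero =>
    intro M hM
    have hP : Projective (R.l.obj (R.e.obj M)) :=
      R.adj_le.map_projective _ ((projective_iff_hasProjectiveDimensionLE_zero _).2 hM)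
    have hP' : HasProjectiveDimensionLT (R.l.obj (R.e.obj M)) 3 :=
      hasProjectiveDimensionLT_of_ge _ 1 3 (by lia)
    have hI : HasProjectiveDimensionLE (Abelian.image (R.adj_le.counit.app M)) 2 :=
      (R.shortExact_image_counit M).hasProjectiveDimensionLT_X₃ 2
        (R.hasProjectiveDimensionLE_one h (R.isZero_e_kernel M)) hP'
    have hQ := R.hasProjectiveDimensionLE_one h (R.isZero_e_cokernel M)
    exact (R.shortExact_cokernel_counit M).hasProjectiveDimensionLT_X₂ 3 hI
      (hasProjectiveDimensionLT_of_ge _ 2 3 (by lia))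
  | succ n ih =>
    intro M hM
    have hS := ShortComplex.shortExact_kernel_projective_π M
    have hP := R.projective_e_obj h (Projective.over M)
    refine (hS.hasProjectiveDimensionLT_X₃_iff (n + 2) (Projective.projective_over M)).2 (ih _ ?_)
    exact ((hS.map_of_exact R.e).hasProjectiveDimensionLT_X₃_iff n hP).1 hM

lemma projective_q_obj (P : B) [Projective P] : Projective (R.q.obj P) :=
  R.adj_qi.map_projective P ‹_›

lemma projective_of_projective_i_obj {X : A} (hX : Projective (R.i.obj X)) : Projective X :=
  Projective.of_iso (asIso (R.adj_qi.counit.app X)) (R.projective_q_obj (R.i.obj X))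

lemma hasProjectiveDimensionLE_one_of_i_obj [EnoughProjectives B] {X : A}
    (hX : HasProjectiveDimensionLE (R.i.obj X) 1) : HasProjectiveDimensionLE X 1 := by
  have hS := ShortComplex.shortExact_kernel_projective_π (R.i.obj X)
  set S := ShortComplex.mk _ _ (kernel.condition (Projective.π (R.i.obj X)))
  have hK : Projective S.X₁ := projective_iff_hasProjectiveDimensionLT_one.2
    ((hS.hasProjectiveDimensionLT_X₃_iff 0 (Projective.projective_over _)).1 hX)
  have := hS.mono_f
  have := hS.epi_g
  have : Epi (R.e.map S.f) := by
    have := (hS.map_of_exact R.e).isIso_f_iff.2 (R.isZero_e_i X)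
    exact inferInstanceAs (Epi (S.map R.e).f)
  have : Mono (R.q.map S.f) := by
    have := R.mono_i_map_q_map S.f
    exact R.i.mono_of_mono_map this
  have hS' : (S.map R.q).ShortExact :=
    { exact := hS.exact.map_of_epi_of_preservesCokernel R.q ‹_› inferInstance
      mono_f := ‹_›
      epi_g := inferInstanceAs (Epi (R.q.map S.g)) }
  have hP : Projective (S.map R.q).X₂ :=
    have : Projective S.X₂ := Projective.projective_over _
    R.projective_q_obj S.X₂
  have : HasProjectiveDimensionLE (R.q.obj (R.i.obj X)) 1 :=
    (hS'.hasProjectiveDimensionLT_X₃_iff 0 hP).2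
      (projective_iff_hasProjectiveDimensionLT_one.1 (R.projective_q_obj S.X₁))
  let φ : R.q.obj (R.i.obj X) ≅ X := asIso (R.adj_qi.counit.app X)
  exact hasProjectiveDimensionLT_of_iso φ 2

/-- If `pd i(A) ≤ 1` for all `A`, then `pd X ≤ pd i(X)`. -/
lemma hasProjectiveDimensionLE_of_i_obj [EnoughProjectives B]
    (h : ∀ X : A, HasProjectiveDimensionLE (R.i.obj X) 1) {n : ℕ} {X : A}
    (hX : HasProjectiveDimensionLE (R.i.obj X) n) : HasProjectiveDimensionLE X n := by
  obtain _ | n := n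
  · rw [← projective_iff_hasProjectiveDimensionLE_zero] at hX ⊢
    exact R.projective_of_projective_i_obj hX
  · have := R.hasProjectiveDimensionLE_one_of_i_obj (h X)
    exact hasProjectiveDimensionLT_of_ge X 2 (n + 1 + 1) (by lia)

end Recollement

/-- Let `(𝒜, ℬ, 𝒞)` be a recollement of abelian categories with enough projectives and
assume `pd_ℬ i(A) ≤ 1` for every object `A` of `𝒜`.  Then
`max {Findim 𝒜, Findim 𝒞} ≤ Findim ℬ ≤ Findim 𝒞 + 2`; in particular `Findim ℬ < ∞` if and
only if `Findim 𝒞 < ∞`. -/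
theorem recollement_findim_of_pgld_le_one {A : Type u₁} {B : Type u₂} {C : Type u₃}
    [Category.{v₁} A] [Category.{v₂} B] [Category.{v₃} C]
    [Abelian A] [Abelian B] [Abelian C]
    [EnoughProjectives A] [EnoughProjectives B] [EnoughProjectives C]
    (R : Recollement A B C)
    (h : ∀ X : A, projDim (R.i.obj X) ≤ (1 : ℕ∞)) :
    max (catFindim A) (catFindim C) ≤ catFindim B ∧
    catFindim B ≤ catFindim C + 2 ∧
    (catFindim B ≠ ⊤ ↔ catFindim C ≠ ⊤) := by
  have h' : ∀ X : A, HasProjectiveDimensionLE (R.i.obj X) 1 := fun X ↦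
    (projDim_le_iff _ 1).1 (by exact_mod_cast h X)
  have hA (X : A) : projDim X ≤ projDim (R.i.obj X) := by
    simpa using projDim_le_add_of_forall 0 fun n hn ↦ R.hasProjectiveDimensionLE_of_i_obj h' hn
  have he (M : B) : projDim (R.e.obj M) ≤ projDim M := by
    simpa using projDim_le_add_of_forall 0 fun n hn ↦ R.hasProjectiveDimensionLE_e_obj h' hn
  have hB (M : B) : projDim M ≤ projDim (R.e.obj M) + 2 :=
    projDim_le_add_of_forall 2 fun n hn ↦ R.hasProjectiveDimensionLE_add_two h' n M hn
  have hle : ∀ X : C, projDim (R.e.obj (R.l.obj X)) = projDim X := fun X ↦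
    projDim_eq_of_iso (asIso (R.adj_le.unit.app X)).symm
  have hAB : catFindim A ≤ catFindim B := iSup₂_le fun X _ ↦
    (hA X).trans (projDim_le_catFindim (ne_top_of_le_ne_top (ENat.natCast_ne_top 1) (h X)))
  have hCB : catFindim C ≤ catFindim B := iSup₂_le fun X hX ↦ by
    refine (hle X).symm.le.trans ((he _).trans (projDim_le_catFindim ?_))
    refine ne_top_of_le_ne_top ?_ (hB _)
    rw [hle]
    exact WithTop.add_ne_top.2 ⟨hX, ENat.natCast_ne_top 2⟩
  have hBC : catFindim B ≤ catFindim C + 2 := iSup₂_le fun M hM ↦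
    (hB M).trans (by gcongr; exact projDim_le_catFindim (ne_top_of_le_ne_top hM (he M)))
  exact ⟨max_le hAB hCB, hBC, fun hb ↦ ne_top_of_le_ne_top hb hCB, fun hc ↦
    ne_top_of_le_ne_top (WithTop.add_ne_top.2 ⟨hc, ENat.natCast_ne_top 2⟩) hBC⟩
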